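/- Let w be a weight on ℝ^d, J ∈ 𝒟 a dyadic cube, and β ∈ Γ_d. Define D_J(w,β) = ŵ(J,β)/⟨w⟩_{E_{β,J}} and C_J(w,β) = ( ⟨w⟩_{E¹_{β,J}} ⟨w⟩_{E²_{β,J}} / ⟨w⟩_{E_{β,J}} )^{1/2}. Then the disbalanced Haar decomposition h_J^β = C_J(w,β) h_J^{w,β} + D_J(w,β) h¹_{E_{β,J}} holds, and moreover ⟨w⟩²_{E_{β,J}} − |E_{β,J}|^{-1} ŵ(J,β)² = ⟨w⟩_{E¹_{β,J}} ⟨w⟩_{E²_{β,J}}. -/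

import Mathlib

open MeasureTheory

noncomputable section

/-- A dyadic cube in `ℝ^d`: the cube `∏ᵢ [mᵢ 2^k, (mᵢ+1) 2^k)`. -/
structure DyadicCube (d : ℕ) where
  k : ℤ
  m : Fin d → ℤ
deriving DecidableEq

namespace DyadicCube

/-- The underlying set of a dyadic cube. -/
def toSet {d : ℕ} (I : DyadicCube d) : Set (Fin d → ℝ) :=
  {x | ∀ i, (I.m i : ℝ) * (2 : ℝ) ^ I.k ≤ x i ∧ x i < ((I.m i : ℝ) + 1) * (2 : ℝ) ^ I.k}

/-- `J` is a dyadic child of `I`. -/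
def IsChild {d : ℕ} (J I : DyadicCube d) : Prop :=
  J.k + 1 = I.k ∧ J.toSet ⊆ I.toSet

end DyadicCube

/-- The index set `Γ_d = {0,1}^d \ {(1,…,1)}`. -/
def Gamma (d : ℕ) : Type := {v : Fin d → Bool // v ≠ fun _ => true}

instance {d : ℕ} : DecidableEq (Gamma d) := Subtype.instDecidableEq

/-- The average `⟨f⟩_E` of `f` over a set `E`. -/
def avg {d : ℕ} (E : Set (Fin d → ℝ)) (f : (Fin d → ℝ) → ℝ) : ℝ :=
  (∫ x in E, f x) / (volume E).toReal

/-- An axis-parallel cube with corner `c` and side length `r`. -/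
def Cube {d : ℕ} (c : Fin d → ℝ) (r : ℝ) : Set (Fin d → ℝ) :=
  {x | ∀ i, c i ≤ x i ∧ x i < c i + r}

/-- `A` is an upper bound for the `A₂` characteristic of `w`:
`⟨w⟩_I ⟨w⁻¹⟩_I ≤ A` for every cube `I`. -/
def IsA2Bound {d : ℕ} (w : (Fin d → ℝ) → ℝ) (A : ℝ) : Prop :=
  ∀ (c : Fin d → ℝ) (r : ℝ), 0 < r →
    avg (Cube c r) w * avg (Cube c r) (fun x => (w x)⁻¹) ≤ A

/-- A weight: a positive, measurable, locally integrable function (with locally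
integrable reciprocal). -/
def IsWeight {d : ℕ} (w : (Fin d → ℝ) → ℝ) : Prop :=
  (∀ x, 0 < w x) ∧ Measurable w ∧ LocallyIntegrable w volume ∧
    LocallyIntegrable (fun x => (w x)⁻¹) volume

/-- The `L¹`-normalized indicator `h¹_E = 1_E / |E|`. -/
def h1 {d : ℕ} (E : Set (Fin d → ℝ)) : (Fin d → ℝ) → ℝ :=
  fun x => ((volume E).toReal)⁻¹ * E.indicator (fun _ => (1 : ℝ)) x

/-- Wilson's system of pairs of sets `(E¹_{α,I}, E²_{α,I})` indexed by dyadic cubes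
`I` and `α ∈ Γ_d`. -/
structure WilsonSystem (d : ℕ) where
  E1 : DyadicCube d → Gamma d → Set (Fin d → ℝ)
  E2 : DyadicCube d → Gamma d → Set (Fin d → ℝ)
  childUnion1 : ∀ I α, ∃ S : Finset (DyadicCube d), S.Nonempty ∧
    (∀ J ∈ S, J.IsChild I) ∧ E1 I α = ⋃ J ∈ S, J.toSet
  childUnion2 : ∀ I α, ∃ S : Finset (DyadicCube d), S.Nonempty ∧
    (∀ J ∈ S, J.IsChild I) ∧ E2 I α = ⋃ J ∈ S, J.toSet
  measEq : ∀ I α, volume (E1 I α) = volume (E2 I α)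
  disj : ∀ I α, Disjoint (E1 I α) (E2 I α)
  nestedOrDisjoint : ∀ I α J β, (I, α) ≠ (J, β) →
    (E1 I α ∪ E2 I α) ⊆ E1 J β ∨ (E1 I α ∪ E2 I α) ⊆ E2 J β ∨
    (E1 J β ∪ E2 J β) ⊆ E1 I α ∨ (E1 J β ∪ E2 J β) ⊆ E2 I α ∨
    Disjoint (E1 I α ∪ E2 I α) (E1 J β ∪ E2 J β)

namespace WilsonSystem

variable {d : ℕ}

/-- `E_{α,I} = E¹_{α,I} ∪ E²_{α,I}`. -/
def E (W : WilsonSystem d) (I : DyadicCube d) (α : Gamma d) : Set (Fin d → ℝ) :=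
  W.E1 I α ∪ W.E2 I α

/-- The Wilson Haar function `h_I^α = |E_{α,I}|^{-1/2} (1_{E²_{α,I}} - 1_{E¹_{α,I}})`. -/
def haar (W : WilsonSystem d) (I : DyadicCube d) (α : Gamma d) : (Fin d → ℝ) → ℝ :=
  fun x => (Real.sqrt (volume (W.E I α)).toReal)⁻¹ *
    ((W.E2 I α).indicator (fun _ => (1 : ℝ)) x - (W.E1 I α).indicator (fun _ => (1 : ℝ)) x)

/-- The Haar coefficient `f̂(I,α) = ⟨f, h_I^α⟩_{L²}`. -/
def hcoef (W : WilsonSystem d) (f : (Fin d → ℝ) → ℝ) (I : DyadicCube d) (α : Gamma d) : ℝ :=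
  ∫ x, f x * W.haar I α x

/-- The weighted Wilson Haar function `h_I^{w,α}`. -/
def haarW (W : WilsonSystem d) (w : (Fin d → ℝ) → ℝ) (I : DyadicCube d) (α : Gamma d) :
    (Fin d → ℝ) → ℝ :=
  fun x => (Real.sqrt (∫ y in W.E I α, w y))⁻¹ *
    (Real.sqrt ((∫ y in W.E1 I α, w y) / (∫ y in W.E2 I α, w y)) *
        (W.E2 I α).indicator (fun _ => (1 : ℝ)) x -
      Real.sqrt ((∫ y in W.E2 I α, w y) / (∫ y in W.E1 I α, w y)) *
        (W.E1 I α).indicator (fun _ => (1 : ℝ)) x)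

/-- The Haar multiplier `T_σ f = ∑_{I,α} σ_{I,α} f̂(I,α) h_I^α`. -/
def Tmult (W : WilsonSystem d) (σ : DyadicCube d → Gamma d → ℝ) (f : (Fin d → ℝ) → ℝ) :
    (Fin d → ℝ) → ℝ :=
  fun x => ∑' p : DyadicCube d × Gamma d, σ p.1 p.2 * W.hcoef f p.1 p.2 * W.haar p.1 p.2 x

/-- The paraproduct `P_a^{(0,0)} f = ∑_{I,α} a_{I,α} f̂(I,α) h_I^α`. -/
def P00 (W : WilsonSystem d) (a : DyadicCube d → Gamma d → ℝ) (f : (Fin d → ℝ) → ℝ) :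
    (Fin d → ℝ) → ℝ :=
  fun x => ∑' p : DyadicCube d × Gamma d, a p.1 p.2 * W.hcoef f p.1 p.2 * W.haar p.1 p.2 x

/-- The paraproduct `P_a^{(0,1)} f = ∑_{I,α} a_{I,α} ⟨f⟩_{E_{α,I}} h_I^α`. -/
def P01 (W : WilsonSystem d) (a : DyadicCube d → Gamma d → ℝ) (f : (Fin d → ℝ) → ℝ) :
    (Fin d → ℝ) → ℝ :=
  fun x => ∑' p : DyadicCube d × Gamma d, a p.1 p.2 * avg (W.E p.1 p.2) f * W.haar p.1 p.2 x

/-- The paraproduct `P_a^{(1,0)} f = ∑_{I,α} a_{I,α} f̂(I,α) h¹_{E_{α,I}}`. -/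
def P10 (W : WilsonSystem d) (a : DyadicCube d → Gamma d → ℝ) (f : (Fin d → ℝ) → ℝ) :
    (Fin d → ℝ) → ℝ :=
  fun x => ∑' p : DyadicCube d × Gamma d, a p.1 p.2 * W.hcoef f p.1 p.2 * h1 (W.E p.1 p.2) x

/-- The dyadic square function
`S f(x) = (∑_{I,α} |f̂(I,α)|² 1_I(x)/|I|)^{1/2}`. -/
def sqFn (W : WilsonSystem d) (f : (Fin d → ℝ) → ℝ) : (Fin d → ℝ) → ℝ :=
  fun x => Real.sqrt (∑' p : DyadicCube d × Gamma d,
    (W.hcoef f p.1 p.2) ^ 2 * p.1.toSet.indicator (fun _ => (1 : ℝ)) x /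
      (volume p.1.toSet).toReal)

/-- The canonical paraproduct of type `ε` built from the function `g`:
`ε = 0` gives `P^{(0,1)}_{ĝ}`, `ε = 1` gives `P^{(1,0)}_{ĝ}`, and `ε = 2` gives
`P^{(0,0)}_{⟨g⟩}`. -/
def paraOf (W : WilsonSystem d) (g : (Fin d → ℝ) → ℝ) (ε : Fin 3) :
    ((Fin d → ℝ) → ℝ) → ((Fin d → ℝ) → ℝ) :=
  if ε = 0 then W.P01 (fun I α => W.hcoef g I α)
  else if ε = 1 then W.P10 (fun I α => W.hcoef g I α)
  else W.P00 (fun I α => avg (W.E I α) g)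

end WilsonSystem

/-- The weighted measure `w(x) dx` on `ℝ^d`. -/
def wMeasure {d : ℕ} (w : (Fin d → ℝ) → ℝ) : Measure (Fin d → ℝ) :=
  volume.withDensity fun x => ENNReal.ofReal (w x)

theorem DyadicCube.toSet_eq_pi {d : ℕ} (I : DyadicCube d) :
    I.toSet = Set.univ.pi fun i => Set.Ico ((I.m i : ℝ) * (2 : ℝ) ^ I.k)
      (((I.m i : ℝ) + 1) * (2 : ℝ) ^ I.k) := by
  ext x
  simp [DyadicCube.toSet, Set.mem_pi]

theorem DyadicCube.measurableSet_toSet {d : ℕ} (I : DyadicCube d) : MeasurableSet I.toSet := by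
  rw [I.toSet_eq_pi]
  exact MeasurableSet.univ_pi fun i => measurableSet_Ico

theorem DyadicCube.volume_toSet_pos {d : ℕ} (I : DyadicCube d) : 0 < volume I.toSet := by
  rw [I.toSet_eq_pi, volume_pi_pi, pos_iff_ne_zero, Finset.prod_ne_zero_iff]
  intro i _
  have h : (0 : ℝ) < (2 : ℝ) ^ I.k := by positivity
  rw [Real.volume_Ico]
  have : (0 : ℝ) < ((I.m i : ℝ) + 1) * (2 : ℝ) ^ I.k - (I.m i : ℝ) * (2 : ℝ) ^ I.k := by
    nlinarith
  exact (ENNReal.ofReal_pos.2 this).ne'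

theorem DyadicCube.toSet_subset_compact {d : ℕ} (I : DyadicCube d) :
    I.toSet ⊆ Set.univ.pi fun i => Set.Icc ((I.m i : ℝ) * (2 : ℝ) ^ I.k)
      (((I.m i : ℝ) + 1) * (2 : ℝ) ^ I.k) := by
  rw [I.toSet_eq_pi]
  exact Set.pi_mono fun i _ => Set.Ico_subset_Icc_self

theorem child_union_facts {d : ℕ} {w : (Fin d → ℝ) → ℝ} (hw : IsWeight w)
    {I : DyadicCube d} {A : Set (Fin d → ℝ)}
    (h : ∃ S : Finset (DyadicCube d), S.Nonempty ∧
      (∀ J ∈ S, J.IsChild I) ∧ A = ⋃ J ∈ S, J.toSet) :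
    MeasurableSet A ∧ 0 < volume A ∧ volume A < ⊤ ∧ IntegrableOn w A ∧ 0 < ∫ x in A, w x := by
  obtain ⟨S, ⟨K, hK⟩, hS, rfl⟩ := h
  have hm : MeasurableSet (⋃ J ∈ S, J.toSet) :=
    S.measurableSet_biUnion fun J _ => J.measurableSet_toSet
  have hp : 0 < volume (⋃ J ∈ S, J.toSet) :=
    K.volume_toSet_pos.trans_le (measure_mono (Set.subset_biUnion_of_mem (u := fun J => J.toSet) hK))
  have hsub : (⋃ J ∈ S, J.toSet) ⊆ _ :=
    (Set.iUnion₂_subset fun J hJ => (hS J hJ).2).trans I.toSet_subset_compact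
  have hc := isCompact_univ_pi (fun i : Fin d =>
    isCompact_Icc (a := (I.m i : ℝ) * (2 : ℝ) ^ I.k) (b := ((I.m i : ℝ) + 1) * (2 : ℝ) ^ I.k))
  have hint : IntegrableOn w (⋃ J ∈ S, J.toSet) :=
    (hw.2.2.1.integrableOn_isCompact hc).mono_set hsub
  refine ⟨hm, hp, (measure_mono hsub).trans_lt hc.measure_lt_top, hint, ?_⟩
  rw [setIntegral_pos_iff_support_of_nonneg_ae
    (Filter.Eventually.of_forall fun x => (hw.1 x).le) hint]
  have : Function.support w = Set.univ := by
    ext x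
    simp [(hw.1 x).ne']
  rwa [this, Set.univ_inter]

/-- The disbalanced Haar decomposition
`h_J^β = C_J(w,β) h_J^{w,β} + D_J(w,β) h¹_{E_{β,J}}`, together with the identity
`⟨w⟩²_{E_{β,J}} - |E_{β,J}|⁻¹ ŵ(J,β)² = ⟨w⟩_{E¹_{β,J}} ⟨w⟩_{E²_{β,J}}`. -/
theorem disbalanced_haar_decomposition (d : ℕ) (W : WilsonSystem d)
    (w : (Fin d → ℝ) → ℝ) (hw : IsWeight w) (J : DyadicCube d) (β : Gamma d) :
    (∀ x, W.haar J β x =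
        Real.sqrt (avg (W.E1 J β) w * avg (W.E2 J β) w / avg (W.E J β) w) *
            W.haarW w J β x +
          W.hcoef w J β / avg (W.E J β) w * h1 (W.E J β) x) ∧
      (avg (W.E J β) w) ^ 2 - ((volume (W.E J β)).toReal)⁻¹ * (W.hcoef w J β) ^ 2 =
        avg (W.E1 J β) w * avg (W.E2 J β) w := by
  obtain ⟨m1, p1, f1, i1, q1⟩ := child_union_facts hw (W.childUnion1 J β)
  obtain ⟨m2, p2, f2, i2, q2⟩ := child_union_facts hw (W.childUnion2 J β)
  have hd := W.disj J β
  have hv : (volume (W.E1 J β)).toReal = (volume (W.E2 J β)).toReal := by rw [W.measEq]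
  have hvE : (volume (W.E J β)).toReal = 2 * (volume (W.E2 J β)).toReal := by
    rw [WilsonSystem.E, measure_union hd m2, ENNReal.toReal_add f1.ne f2.ne, hv]
    ring
  have hv0 : 0 < (volume (W.E2 J β)).toReal := ENNReal.toReal_pos p2.ne' f2.ne
  have hE : ∫ x in W.E J β, w x = (∫ x in W.E1 J β, w x) + ∫ x in W.E2 J β, w x := by
    rw [WilsonSystem.E, setIntegral_union hd m2 i1 i2]
  have hco : W.hcoef w J β = (√(2 * (volume (W.E2 J β)).toReal))⁻¹ *
      ((∫ x in W.E2 J β, w x) - ∫ x in W.E1 J β, w x) := by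
    rw [WilsonSystem.hcoef, ← integral_indicator m1, ← integral_indicator m2,
      ← integral_sub (i2.integrable_indicator m2) (i1.integrable_indicator m1),
      ← integral_const_mul]
    congr 1
    ext x
    simp only [WilsonSystem.haar, hvE]
    by_cases h1 : x ∈ W.E1 J β <;> by_cases h2 : x ∈ W.E2 J β <;> simp [h1, h2] <;> ring
  simp only [avg, WilsonSystem.haar, WilsonSystem.haarW, h1, hco, hE, hvE, hv]
  generalize (volume (W.E2 J β)).toReal = v at *
  generalize (∫ x in W.E1 J β, w x) = a at *
  generalize (∫ x in W.E2 J β, w x) = b at *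
  have hs : 0 < √(2 * v) := Real.sqrt_pos.2 (by linarith)
  have hs2 : √(2 * v) ^ 2 = 2 * v := Real.sq_sqrt (by linarith)
  have hA : 0 < √a := Real.sqrt_pos.2 q1
  have hA2 : √a ^ 2 = a := Real.sq_sqrt q1.le
  have hB : 0 < √b := Real.sqrt_pos.2 q2
  have hB2 : √b ^ 2 = b := Real.sq_sqrt q2.le
  have hT : 0 < √(a + b) := Real.sqrt_pos.2 (by linarith)
  have hT2 : √(a + b) ^ 2 = a + b := Real.sq_sqrt (by linarith)
  have hC : √(a / v * (b / v) / ((a + b) / (2 * v))) = 2 * √a * √b / (√(2 * v) * √(a + b)) := by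
    rw [Real.sqrt_eq_iff_mul_self_eq (by positivity) (by positivity), ← pow_two, div_pow, mul_pow,
      mul_pow, mul_pow, hs2, hA2, hB2, hT2]
    field_simp
    try ring
  have hab : a + b ≠ 0 := by linarith
  refine ⟨fun x => ?_, ?_⟩
  · rw [hC, Real.sqrt_div q1.le, Real.sqrt_div q2.le]
    have e2 : 2 * √a * √b / (√(2 * v) * √(a + b)) * ((√(a + b))⁻¹ * (√a / √b)) =
        2 * a / (√(2 * v) * (a + b)) := by
      rw [← hT2, ← hA2]
      simp only [hA2, hT2]
      field_simp
      simp only [hA2, hT2]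
      try field_simp
    have e1 : 2 * √a * √b / (√(2 * v) * √(a + b)) * ((√(a + b))⁻¹ * (√b / √a)) =
        2 * b / (√(2 * v) * (a + b)) := by
      field_simp
      simp only [hB2, hT2]
      try field_simp
    have e3 : (√(2 * v))⁻¹ * (b - a) / ((a + b) / (2 * v)) * (2 * v)⁻¹ =
        (b - a) / (√(2 * v) * (a + b)) := by
      field_simp
    by_cases h1 : x ∈ W.E1 J β
    · have h2 : x ∉ W.E2 J β := Set.disjoint_left.1 hd h1
      have h3 : x ∈ W.E J β := Or.inl h1
      simp only [Set.indicator_of_mem h1, Set.indicator_of_notMem h2, Set.indicator_of_mem h3,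
        mul_one, mul_zero, zero_sub, mul_neg, e1, e3]
      field_simp
      ring
    · by_cases h2 : x ∈ W.E2 J β
      · have h3 : x ∈ W.E J β := Or.inr h2
        simp only [Set.indicator_of_notMem h1, Set.indicator_of_mem h2, Set.indicator_of_mem h3,
          mul_one, mul_zero, sub_zero, e2, e3]
        field_simp
        ring
      · have h3 : x ∉ W.E J β := fun h => h.elim h1 h2
        simp [h1, h2, h3]
  · rw [mul_pow, inv_pow, hs2]
    field_simp
    ring
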